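/- arXiv:2310.19077 — 4 statements merged into one kernel-verified Lean document; each statement's English description precedes it below -/
import Mathlib

section
/- Let W_EI(T) denote the optimal value of the linear program EI(T) with arrival rates λ_j^t. Let μ be any probability distribution on nonnegative-integer arrival-count matrices a = (a_j^t)_{j∈[J], t∈[T]} whose coordinate means satisfy E_μ[a_j^t] = λ_j^t < ∞ for all j and t, and let M(a) denote the optimal value of the integer program RI(T; a). Then the expectation of M under μ is at most the LP value: E_μ[M(a)] ≤ W_EI(T). -/
open Finset

variable {V : Type} [Fintype V] [DecidableEq V]

/-- `L̄`: the links of the network together with all self-loops. -/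
def Lbar (L : Finset (V × V)) : Finset (V × V) :=
  L ∪ Finset.univ.image (fun v => (v, v))

/-- A route-schedule for a packet type with source `s`, destination `z` and deadline `d`:
a directed walk `k = (k_0, …, k_d)` of edges of `L̄` with `k_0` going out of `s`
and `k_d` going into `z`. -/
def IsRouteSchedule (L : Finset (V × V)) (s z : V) (d : ℕ)
    (k : Fin (d + 1) → V × V) : Prop :=
  (∀ τ, k τ ∈ Lbar L) ∧
  (∀ τ : Fin (d + 1), ∀ h : (τ : ℕ) + 1 < d + 1, (k τ).2 = (k ⟨(τ : ℕ) + 1, h⟩).1) ∧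
  (k 0).1 = s ∧ (k (Fin.last d)).2 = z

open Classical in
/-- The (finite) set `K` of all route-schedules for source `s`, destination `z`,
deadline `d`. -/
noncomputable def RS (L : Finset (V × V)) (s z : V) (d : ℕ) :
    Finset (Fin (d + 1) → V × V) :=
  Finset.univ.filter (IsRouteSchedule L s z d)

open Classical in
/-- `∑_{k ∈ K : k_τ = ℓ} x_k`, with the convention that the indicator `[k_τ = ℓ]` is `0`
when `τ ∉ {0, …, d}`. -/
noncomputable def schedAt (L : Finset (V × V)) (s z : V) (d : ℕ)
    (x : (Fin (d + 1) → V × V) → ℝ) (τ : ℕ) (ℓ : V × V) : ℝ :=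
  ∑ k ∈ RS L s z d, if h : τ < d + 1 then (if k ⟨τ, h⟩ = ℓ then x k else 0) else 0

/-- Maximum deadline `d_max` over all packet types. -/
def dmax {J : ℕ} (d : Fin J → ℕ) : ℕ := Finset.univ.sup d

/-- Objective of the expected-instance LP `EI(T)`:
`∑_{t=1}^T ∑_j w_j λ_j^t ∑_{k ∈ K_j} x_{jk}^t`. -/
noncomputable def EIObj (L : Finset (V × V)) {J : ℕ} (src dst : Fin J → V)
    (d : Fin J → ℕ) (w : Fin J → ℝ) (T : ℕ) (lam : Fin J → ℕ → ℝ)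
    (x : (j : Fin J) → (Fin (d j + 1) → V × V) → ℕ → ℝ) : ℝ :=
  ∑ t ∈ Finset.Icc 1 T, ∑ j,
    w j * lam j t * ∑ k ∈ RS L (src j) (dst j) (d j), x j k t

/-- Feasibility for `EI(T)`: `x ≥ 0`; `∑_{k ∈ K_j} x_{jk}^t ≤ 1` for all `j ∈ [J]`,
`t ∈ [T]`; and for every `ℓ ∈ L` and `t ∈ [T + d_max]`:
`∑_{τ = max(t - d_max, 1)}^{min(t,T)} ∑_j λ_j^τ ∑_{k ∈ K_j : k_{t-τ} = ℓ} x_{jk}^τ ≤ C_ℓ`. -/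
def EIFeasible (L : Finset (V × V)) (C : V × V → ℝ) {J : ℕ} (src dst : Fin J → V)
    (d : Fin J → ℕ) (T : ℕ) (lam : Fin J → ℕ → ℝ)
    (x : (j : Fin J) → (Fin (d j + 1) → V × V) → ℕ → ℝ) : Prop :=
  (∀ j k t, 0 ≤ x j k t) ∧
  (∀ j, ∀ t ∈ Finset.Icc 1 T, ∑ k ∈ RS L (src j) (dst j) (d j), x j k t ≤ 1) ∧
  (∀ ℓ ∈ L, ∀ t ∈ Finset.Icc 1 (T + dmax d),
    ∑ τ ∈ Finset.Icc (max (t - dmax d) 1) (min t T), ∑ j,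
      lam j τ * schedAt L (src j) (dst j) (d j) (fun k => x j k τ) (t - τ) ℓ ≤ C ℓ)

/-- `W_EI(T)`: the optimal value of the LP `EI(T)`. -/
noncomputable def EIOpt (L : Finset (V × V)) (C : V × V → ℝ) {J : ℕ}
    (src dst : Fin J → V) (d : Fin J → ℕ) (w : Fin J → ℝ) (T : ℕ)
    (lam : Fin J → ℕ → ℝ) : ℝ :=
  sSup {r : ℝ | ∃ x, EIFeasible L C src dst d T lam x ∧ EIObj L src dst d w T lam x = r}

/-- Objective of the random integer program `RI(T; a)`:
`∑_{t=1}^T ∑_j w_j ∑_{n=1}^{a_j^t} ∑_{k ∈ K_j} y_{jk}^{nt}`. -/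
noncomputable def RIObj (L : Finset (V × V)) {J : ℕ} (src dst : Fin J → V)
    (d : Fin J → ℕ) (w : Fin J → ℝ) (T : ℕ) (a : Fin J → ℕ → ℕ)
    (y : (j : Fin J) → (Fin (d j + 1) → V × V) → ℕ → ℕ → ℝ) : ℝ :=
  ∑ t ∈ Finset.Icc 1 T, ∑ j, w j * ∑ n ∈ Finset.Icc 1 (a j t),
    ∑ k ∈ RS L (src j) (dst j) (d j), y j k n t

/-- Feasibility for `RI(T; a)`: `y_{jk}^{nt} ∈ {0,1}`; each packet uses at most one
route-schedule; and the link capacities hold at every time `t ∈ [T + d_max]`. -/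
def RIFeasible (L : Finset (V × V)) (C : V × V → ℝ) {J : ℕ} (src dst : Fin J → V)
    (d : Fin J → ℕ) (T : ℕ) (a : Fin J → ℕ → ℕ)
    (y : (j : Fin J) → (Fin (d j + 1) → V × V) → ℕ → ℕ → ℝ) : Prop :=
  (∀ j k n t, y j k n t = 0 ∨ y j k n t = 1) ∧
  (∀ j, ∀ t ∈ Finset.Icc 1 T, ∀ n ∈ Finset.Icc 1 (a j t),
    ∑ k ∈ RS L (src j) (dst j) (d j), y j k n t ≤ 1) ∧
  (∀ ℓ ∈ L, ∀ t ∈ Finset.Icc 1 (T + dmax d),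
    ∑ τ ∈ Finset.Icc (max (t - dmax d) 1) (min t T), ∑ j, ∑ n ∈ Finset.Icc 1 (a j τ),
      schedAt L (src j) (dst j) (d j) (fun k => y j k n τ) (t - τ) ℓ ≤ C ℓ)

/-- `M(a)`: the optimal value of the integer program `RI(T; a)`. -/
noncomputable def RIOpt (L : Finset (V × V)) (C : V × V → ℝ) {J : ℕ}
    (src dst : Fin J → V) (d : Fin J → ℕ) (w : Fin J → ℝ) (T : ℕ)
    (a : Fin J → ℕ → ℕ) : ℝ :=
  sSup {r : ℝ | ∃ y, RIFeasible L C src dst d T a y ∧ RIObj L src dst d w T a y = r}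

/-- The incidence indicator `[k_τ = ℓ]`, as a real number. -/
noncomputable def schedCoeff {d : ℕ} (τ : ℕ) (ℓ : V × V) (k : Fin (d + 1) → V × V) : ℝ :=
  if h : τ < d + 1 then (if k ⟨τ, h⟩ = ℓ then 1 else 0) else 0

lemma schedAt_eq_sum (L : Finset (V × V)) (s z : V) (d : ℕ)
    (x : (Fin (d + 1) → V × V) → ℝ) (τ : ℕ) (ℓ : V × V) :
    schedAt L s z d x τ ℓ = ∑ k ∈ RS L s z d, schedCoeff τ ℓ k * x k := by
  unfold schedAt schedCoeff
  refine Finset.sum_congr rfl fun k _ => ?_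
  split_ifs <;> simp

lemma sum_schedAt (L : Finset (V × V)) (s z : V) (d : ℕ) {ι : Type*} (S : Finset ι)
    (x : (Fin (d + 1) → V × V) → ι → ℝ) (τ : ℕ) (ℓ : V × V) :
    ∑ n ∈ S, schedAt L s z d (fun k => x k n) τ ℓ =
      schedAt L s z d (fun k => ∑ n ∈ S, x k n) τ ℓ := by
  simp only [schedAt_eq_sum, Finset.mul_sum]
  exact Finset.sum_comm

lemma mul_schedAt (L : Finset (V × V)) (s z : V) (d : ℕ) (c : ℝ)
    (x : (Fin (d + 1) → V × V) → ℝ) (τ : ℕ) (ℓ : V × V) :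
    c * schedAt L s z d x τ ℓ = schedAt L s z d (fun k => c * x k) τ ℓ := by
  simp only [schedAt_eq_sum, Finset.mul_sum]
  exact Finset.sum_congr rfl fun k _ => by ring

section Objective

variable {L : Finset (V × V)} {C : V × V → ℝ} {J : ℕ} {src dst : Fin J → V}
  {d : Fin J → ℕ} {w : Fin J → ℝ} {T : ℕ}

lemma EIObj_le {lam : Fin J → ℕ → ℝ} (hw : ∀ j, 0 ≤ w j)
    (hlam : ∀ j, ∀ t ∈ Finset.Icc 1 T, 0 ≤ lam j t)
    {x : (j : Fin J) → (Fin (d j + 1) → V × V) → ℕ → ℝ}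
    (hx : EIFeasible L C src dst d T lam x) :
    EIObj L src dst d w T lam x ≤ ∑ t ∈ Finset.Icc 1 T, ∑ j, w j * lam j t := by
  refine Finset.sum_le_sum fun t ht => Finset.sum_le_sum fun j _ => ?_
  exact mul_le_of_le_one_right (mul_nonneg (hw j) (hlam j t ht)) (hx.2.1 j t ht)

lemma EIObj_le_EIOpt {lam : Fin J → ℕ → ℝ} (hw : ∀ j, 0 ≤ w j)
    (hlam : ∀ j, ∀ t ∈ Finset.Icc 1 T, 0 ≤ lam j t)
    {x : (j : Fin J) → (Fin (d j + 1) → V × V) → ℕ → ℝ}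
    (hx : EIFeasible L C src dst d T lam x) :
    EIObj L src dst d w T lam x ≤ EIOpt L C src dst d w T lam := by
  refine le_csSup ⟨∑ t ∈ Finset.Icc 1 T, ∑ j, w j * lam j t, ?_⟩ ⟨x, hx, rfl⟩
  rintro r ⟨x', hx', rfl⟩
  exact EIObj_le hw hlam hx'

lemma RIFeasible_zero (hC : ∀ ℓ ∈ L, 0 < C ℓ) (a : Fin J → ℕ → ℕ) :
    RIFeasible L C src dst d T a (fun _ _ _ _ => 0) := by
  refine ⟨fun _ _ _ _ => Or.inl rfl, fun _ _ _ _ _ => by simp, fun ℓ hℓ t _ => ?_⟩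
  simpa [schedAt_eq_sum] using (hC ℓ hℓ).le

lemma exists_RIFeasible_lt (hC : ∀ ℓ ∈ L, 0 < C ℓ) (a : Fin J → ℕ → ℕ) {ε : ℝ} (hε : 0 < ε) :
    ∃ y, RIFeasible L C src dst d T a y ∧
      RIOpt L C src dst d w T a < RIObj L src dst d w T a y + ε := by
  obtain ⟨r, ⟨y, hy, rfl⟩, hr⟩ := exists_lt_of_lt_csSup
    (s := {r : ℝ | ∃ y, RIFeasible L C src dst d T a y ∧ RIObj L src dst d w T a y = r})
    ⟨_, _, RIFeasible_zero hC a, rfl⟩ (sub_lt_self (RIOpt L C src dst d w T a) hε)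
  exact ⟨y, hy, by linarith⟩

lemma RIFeasible_congr {a b : Fin J → ℕ → ℕ} (hab : ∀ j, ∀ t ∈ Finset.Icc 1 T, a j t = b j t)
    (y : (j : Fin J) → (Fin (d j + 1) → V × V) → ℕ → ℕ → ℝ) :
    RIFeasible L C src dst d T a y ↔ RIFeasible L C src dst d T b y := by
  unfold RIFeasible
  refine and_congr_right fun _ => and_congr ?_ ?_
  · refine forall_congr' fun j => forall₂_congr fun t ht => ?_
    rw [hab j t ht]
  · refine forall₂_congr fun ℓ _ => forall₂_congr fun t _ => ?_
    rw [Finset.sum_congr rfl fun τ hτ => Finset.sum_congr rfl fun j _ => by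
      rw [hab j τ (by simp only [Finset.mem_Icc] at hτ ⊢; omega)]]

lemma RIObj_congr {a b : Fin J → ℕ → ℕ} (hab : ∀ j, ∀ t ∈ Finset.Icc 1 T, a j t = b j t)
    (y : (j : Fin J) → (Fin (d j + 1) → V × V) → ℕ → ℕ → ℝ) :
    RIObj L src dst d w T a y = RIObj L src dst d w T b y :=
  Finset.sum_congr rfl fun t ht => Finset.sum_congr rfl fun j _ => by rw [hab j t ht]

lemma RIOpt_congr {a b : Fin J → ℕ → ℕ} (hab : ∀ j, ∀ t ∈ Finset.Icc 1 T, a j t = b j t) :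
    RIOpt L C src dst d w T a = RIOpt L C src dst d w T b := by
  simp only [RIOpt, RIFeasible_congr hab, RIObj_congr hab]

end Objective

/-- Near-optimal solutions of the integer programs can be chosen to depend on the arrival counts
only through the finitely many relevant coordinates, so that the resulting aggregate flows are
measurable. -/
lemma exists_measurable_flow
    {L : Finset (V × V)} {C : V × V → ℝ} (hC : ∀ ℓ ∈ L, 0 < C ℓ)
    {J : ℕ} (src dst : Fin J → V) (d : Fin J → ℕ) (w : Fin J → ℝ) (T : ℕ)
    {ε : ℝ} (hε : 0 < ε) :
    ∃ z : (Fin J → ℕ → ℕ) → (j : Fin J) → (Fin (d j + 1) → V × V) → ℕ → ℝ,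
      (∀ j k t, Measurable fun a => z a j k t) ∧
      (∀ a j k t, 0 ≤ z a j k t) ∧
      (∀ a j, ∀ t ∈ Finset.Icc 1 T, ∑ k ∈ RS L (src j) (dst j) (d j), z a j k t ≤ a j t) ∧
      (∀ a, ∀ ℓ ∈ L, ∀ t ∈ Finset.Icc 1 (T + dmax d),
        ∑ τ ∈ Finset.Icc (max (t - dmax d) 1) (min t T), ∑ j,
          schedAt L (src j) (dst j) (d j) (fun k => z a j k τ) (t - τ) ℓ ≤ C ℓ) ∧
      (∀ a, RIOpt L C src dst d w T a ≤ (∑ t ∈ Finset.Icc 1 T, ∑ j,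
        w j * ∑ k ∈ RS L (src j) (dst j) (d j), z a j k t) + ε) := by
  let fill (b : Fin J → Fin (T + 1) → ℕ) : Fin J → ℕ → ℕ :=
    fun j t => if h : t < T + 1 then b j ⟨t, h⟩ else 0
  let res (a : Fin J → ℕ → ℕ) : Fin J → Fin (T + 1) → ℕ := fun j i => a j i
  have h_fill : ∀ a j, ∀ t ∈ Finset.Icc 1 T, fill (res a) j t = a j t := by
    intro a j t ht
    have : t < T + 1 := by rw [Finset.mem_Icc] at ht; omega
    simp only [fill, res, dif_pos this]
  have h_res : Measurable res := by
    refine measurable_pi_lambda _ fun j => measurable_pi_lambda _ fun i => ?_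
    exact (measurable_pi_apply (i : ℕ)).comp (measurable_pi_apply j)
  choose Y hY hYopt using fun b => exists_RIFeasible_lt (src := src) (dst := dst) (d := d)
    (w := w) (T := T) hC (fill b) hε
  let Z (b : Fin J → Fin (T + 1) → ℕ) (j : Fin J) (k : Fin (d j + 1) → V × V) (t : ℕ) : ℝ :=
    ∑ n ∈ Finset.Icc 1 (fill b j t), Y b j k n t
  refine ⟨fun a => Z (res a), fun j k t => ?_, fun a j k t => ?_, fun a j t ht => ?_,
    fun a ℓ hℓ t ht => ?_, fun a => ?_⟩
  · exact (measurable_of_countable fun b => Z b j k t).comp h_res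
  · refine Finset.sum_nonneg fun n _ => ?_
    rcases (hY (res a)).1 j k n t with h | h <;> rw [h]
    exact zero_le_one
  · simp only [Z]
    rw [Finset.sum_comm]
    calc _ ≤ ∑ n ∈ Finset.Icc 1 (fill (res a) j t), (1 : ℝ) :=
          Finset.sum_le_sum fun n hn => (hY (res a)).2.1 j t ht n hn
      _ = a j t := by simp [h_fill a j t ht]
  · simpa only [sum_schedAt] using (hY (res a)).2.2 ℓ hℓ t ht
  · rw [← RIOpt_congr (h_fill a)]
    refine (hYopt (res a)).le.trans_eq ?_
    simp only [RIObj, Z]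
    congr 1
    refine Finset.sum_congr rfl fun t _ => Finset.sum_congr rfl fun j _ => ?_
    rw [Finset.sum_comm]

open MeasureTheory in
/-- The expected optimal value of the random integer program is at most the optimal
value of the expected-instance LP: for any probability distribution `μ` on arrival
matrices `a = (a_j^t)` whose coordinate means are `E_μ[a_j^t] = λ_j^t < ∞`,
`E_μ[M(a)] ≤ W_EI(T)`. -/
theorem stmt0 {V : Type} [Fintype V] [DecidableEq V]
    (L : Finset (V × V)) (C : V × V → ℝ) (hC : ∀ ℓ ∈ L, 0 < C ℓ)
    {J : ℕ} (hJ : 1 ≤ J) (src dst : Fin J → V) (d : Fin J → ℕ)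
    (w : Fin J → ℝ) (hw : ∀ j, 0 ≤ w j)
    (T : ℕ) (hT : 1 ≤ T) (lam : Fin J → ℕ → ℝ)
    (μ : Measure (Fin J → ℕ → ℕ)) [IsProbabilityMeasure μ]
    (hInt : ∀ j, ∀ t ∈ Finset.Icc 1 T, Integrable (fun a => (a j t : ℝ)) μ)
    (hMean : ∀ j, ∀ t ∈ Finset.Icc 1 T, ∫ a, (a j t : ℝ) ∂μ = lam j t)
    (hMInt : Integrable (fun a => RIOpt L C src dst d w T a) μ) :
    ∫ a, RIOpt L C src dst d w T a ∂μ ≤ EIOpt L C src dst d w T lam := by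
  have hlam : ∀ j, ∀ t ∈ Finset.Icc 1 T, 0 ≤ lam j t := fun j t ht => by
    rw [← hMean j t ht]
    exact integral_nonneg fun a => Nat.cast_nonneg _
  refine le_of_forall_pos_le_add fun ε hε => ?_
  obtain ⟨z, hz_meas, hz_nonneg, hz_le, hz_cap, hz_opt⟩ :=
    exists_measurable_flow hC src dst d w T hε
  have hz_int : ∀ j, ∀ k ∈ RS L (src j) (dst j) (d j), ∀ t ∈ Finset.Icc 1 T,
      Integrable (fun a => z a j k t) μ := by
    intro j k hk t ht
    refine (hInt j t ht).mono' (hz_meas j k t).aestronglyMeasurable (.of_forall fun a => ?_)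
    rw [Real.norm_of_nonneg (hz_nonneg a j k t)]
    exact (Finset.single_le_sum (fun k _ => hz_nonneg a j k t) hk).trans (hz_le a j t ht)
  have hE_sum : ∀ j, ∀ t ∈ Finset.Icc 1 T,
      ∑ k ∈ RS L (src j) (dst j) (d j), ∫ a, z a j k t ∂μ ≤ lam j t := by
    intro j t ht
    rw [← integral_finsetSum _ fun k hk => hz_int j k hk t ht, ← hMean j t ht]
    exact integral_mono (integrable_finsetSum _ fun k hk => hz_int j k hk t ht) (hInt j t ht)
      fun a => hz_le a j t ht
  have hE_nonneg : ∀ j k t, 0 ≤ ∫ a, z a j k t ∂μ := fun j k t =>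
    integral_nonneg fun a => hz_nonneg a j k t
  let x (j : Fin J) (k : Fin (d j + 1) → V × V) (t : ℕ) : ℝ := (∫ a, z a j k t ∂μ) / |lam j t|
  have hx : ∀ j, ∀ k ∈ RS L (src j) (dst j) (d j), ∀ t ∈ Finset.Icc 1 T,
      lam j t * x j k t = ∫ a, z a j k t ∂μ := by
    intro j k hk t ht
    have hle := (Finset.single_le_sum (fun k _ => hE_nonneg j k t) hk).trans (hE_sum j t ht)
    simp only [x, abs_of_nonneg (hlam j t ht)]
    refine mul_div_cancel_of_imp' fun h0 => ?_
    exact le_antisymm (h0 ▸ hle) (hE_nonneg j k t)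
  have hx_feas : EIFeasible L C src dst d T lam x := by
    refine ⟨fun j k t => div_nonneg (hE_nonneg j k t) (abs_nonneg _), fun j t ht => ?_,
      fun ℓ hℓ t ht => ?_⟩
    · simp only [x, ← Finset.sum_div]
      exact div_le_one_of_le₀ ((hE_sum j t ht).trans (le_abs_self _)) (abs_nonneg _)
    · have hmem : ∀ τ ∈ Finset.Icc (max (t - dmax d) 1) (min t T), τ ∈ Finset.Icc 1 T := by
        intro τ hτ
        simp only [Finset.mem_Icc] at hτ ⊢
        omega
      have hc_int : ∀ τ ∈ Finset.Icc (max (t - dmax d) 1) (min t T), ∀ j,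
          ∀ k ∈ RS L (src j) (dst j) (d j),
          Integrable (fun a => schedCoeff (t - τ) ℓ k * z a j k τ) μ :=
        fun τ hτ j k hk => (hz_int j k hk τ (hmem τ hτ)).const_mul _
      calc _ = ∫ a, ∑ τ ∈ Finset.Icc (max (t - dmax d) 1) (min t T), ∑ j,
            schedAt L (src j) (dst j) (d j) (fun k => z a j k τ) (t - τ) ℓ ∂μ := by
            simp only [mul_schedAt]
            simp only [schedAt_eq_sum]
            rw [integral_finsetSum _ fun τ hτ => integrable_finsetSum _ fun j _ =>
              integrable_finsetSum _ (hc_int τ hτ j)]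
            refine Finset.sum_congr rfl fun τ hτ => ?_
            rw [integral_finsetSum _ fun j _ => integrable_finsetSum _ (hc_int τ hτ j)]
            refine Finset.sum_congr rfl fun j _ => ?_
            rw [integral_finsetSum _ (hc_int τ hτ j)]
            refine Finset.sum_congr rfl fun k hk => ?_
            rw [integral_const_mul, hx j k hk τ (hmem τ hτ)]
        _ ≤ ∫ _, C ℓ ∂μ := by
            refine integral_mono ?_ (integrable_const _) fun a => hz_cap a ℓ hℓ t ht
            simp only [schedAt_eq_sum]
            exact integrable_finsetSum _ fun τ hτ => integrable_finsetSum _ fun j _ =>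
              integrable_finsetSum _ (hc_int τ hτ j)
        _ = C ℓ := by simp
  have hc_int : ∀ t ∈ Finset.Icc 1 T, ∀ j, Integrable
      (fun a => w j * ∑ k ∈ RS L (src j) (dst j) (d j), z a j k t) μ := fun t ht j =>
    (integrable_finsetSum _ fun k hk => hz_int j k hk t ht).const_mul _
  have hobj_int : Integrable (fun a => ∑ t ∈ Finset.Icc 1 T, ∑ j,
      w j * ∑ k ∈ RS L (src j) (dst j) (d j), z a j k t) μ :=
    integrable_finsetSum _ fun t ht => integrable_finsetSum _ fun j _ => hc_int t ht j
  calc ∫ a, RIOpt L C src dst d w T a ∂μ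
      ≤ ∫ a, ((∑ t ∈ Finset.Icc 1 T, ∑ j,
          w j * ∑ k ∈ RS L (src j) (dst j) (d j), z a j k t) + ε) ∂μ :=
        integral_mono hMInt (hobj_int.add (integrable_const _)) hz_opt
    _ = EIObj L src dst d w T lam x + ε := by
        rw [integral_add hobj_int (integrable_const _),
          integral_finsetSum _ fun t ht => integrable_finsetSum _ fun j _ => hc_int t ht j]
        simp only [integral_const, probReal_univ, one_smul, EIObj]
        congr 1
        refine Finset.sum_congr rfl fun t ht => ?_
        rw [integral_finsetSum _ fun j _ => hc_int t ht j]
        refine Finset.sum_congr rfl fun j _ => ?_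
        rw [integral_const_mul, integral_finsetSum _ fun k hk => hz_int j k hk t ht,
          mul_assoc, Finset.mul_sum _ _ (lam j t)]
        exact congrArg _ (Finset.sum_congr rfl fun k hk => (hx j k hk t ht).symm)
    _ ≤ EIOpt L C src dst d w T lam + ε := by
        gcongr
        exact EIObj_le_EIOpt hw hlam hx_feas
end

section
/- Suppose the arrival rates are stationary, λ_j^t ≡ λ_j ≥ 0 for all t ∈ [T]. Then there exists a stationary feasible solution of EI(T), i.e. a family x with x_{jk}^t = x̄_{jk} independent of t that satisfies all constraints of EI(T), whose objective value Σ_{t=1}^T Σ_j w_j λ_j Σ_{k∈K_j} x̄_{jk} is at least (1 − 2·d_max²/T) · W_EI(T); moreover the objective value of any feasible solution, in particular this one, is at most W_EI(T). -/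
open Finset

variable {V : Type} [Fintype V] [DecidableEq V]

lemma schedAt_nonneg (L : Finset (V × V)) (s z : V) (d : ℕ)
    {x : (Fin (d + 1) → V × V) → ℝ} (hx : ∀ k, 0 ≤ x k) (τ : ℕ) (ℓ : V × V) :
    0 ≤ schedAt L s z d x τ ℓ := by
  unfold schedAt
  refine Finset.sum_nonneg fun k _ => ?_
  split_ifs <;> simp [hx]

lemma schedAt_congr (L : Finset (V × V)) (s z : V) (d : ℕ)
    {x y : (Fin (d + 1) → V × V) → ℝ} (h : ∀ k ∈ RS L s z d, x k = y k) (τ : ℕ) (ℓ : V × V) :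
    schedAt L s z d x τ ℓ = schedAt L s z d y τ ℓ := by
  unfold schedAt
  exact Finset.sum_congr rfl fun k hk => by rw [h k hk]

lemma schedAt_const_mul_sum {ι : Type*} (L : Finset (V × V)) (s z : V) (d : ℕ)
    (c : ℝ) (I : Finset ι) (x : ι → (Fin (d + 1) → V × V) → ℝ) (τ : ℕ) (ℓ : V × V) :
    schedAt L s z d (fun k => c * ∑ i ∈ I, x i k) τ ℓ =
      c * ∑ i ∈ I, schedAt L s z d (x i) τ ℓ := by
  unfold schedAt
  rw [Finset.sum_comm, Finset.mul_sum]
  refine Finset.sum_congr rfl fun k _ => ?_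
  split_ifs <;> simp

lemma continuous_schedAt (L : Finset (V × V)) (s z : V) (d τ : ℕ) (ℓ : V × V) :
    Continuous fun x : (Fin (d + 1) → V × V) → ℝ => schedAt L s z d x τ ℓ := by
  unfold schedAt
  refine continuous_finsetSum _ fun k _ => ?_
  split_ifs <;> fun_prop

/-- Summing the windowed loads over all time slots counts every (departure, delay) pair once. -/
lemma sum_window_eq (T D : ℕ) (a : ℕ → ℕ → ℝ) :
    ∑ t ∈ Finset.Icc 1 (T + D), ∑ τ ∈ Finset.Icc (max (t - D) 1) (min t T), a τ (t - τ) =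
      ∑ τ ∈ Finset.Icc 1 T, ∑ s ∈ Finset.range (D + 1), a τ s := by
  rw [Finset.sum_sigma', Finset.sum_sigma']
  refine Finset.sum_bij' (fun p _ => ⟨p.2, p.1 - p.2⟩) (fun p _ => ⟨p.1 + p.2, p.1⟩) ?_ ?_ ?_ ?_ ?_
  · rintro ⟨t, τ⟩ h
    simp only [Finset.mem_sigma, Finset.mem_Icc, Finset.mem_range] at h ⊢
    omega
  · rintro ⟨τ, s⟩ h
    simp only [Finset.mem_sigma, Finset.mem_Icc, Finset.mem_range] at h ⊢
    omega
  · rintro ⟨t, τ⟩ h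
    simp only [Finset.mem_sigma, Finset.mem_Icc] at h
    have : τ + (t - τ) = t := by omega
    simp [this]
  · rintro ⟨τ, s⟩ _
    simp
  · rintro ⟨t, τ⟩ _
    rfl

/-- A window of time slots contributes at most one term for each delay in `{0, …, D}`. -/
lemma sum_window_le (t T D : ℕ) {b : ℕ → ℝ} (hb : ∀ s, 0 ≤ b s) :
    ∑ τ ∈ Finset.Icc (max (t - D) 1) (min t T), b (t - τ) ≤ ∑ s ∈ Finset.range (D + 1), b s := by
  have hinj : Set.InjOn (fun τ => t - τ) (Finset.Icc (max (t - D) 1) (min t T) : Finset ℕ) := by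
    intro p hp q hq h
    simp only [Finset.coe_Icc, Set.mem_Icc] at hp hq h
    omega
  rw [← Finset.sum_image (f := b) hinj]
  refine Finset.sum_le_sum_of_subset_of_nonneg ?_ fun s _ _ => hb s
  intro s hs
  simp only [Finset.mem_image, Finset.mem_Icc, Finset.mem_range] at hs ⊢
  omega

section TimeAverage

variable (L : Finset (V × V)) {J : ℕ} (src dst : Fin J → V) (d : Fin J → ℕ) (T : ℕ)

open Classical in
/-- The sum over time of a solution, divided by `T + d_max` and supported on route-schedules. -/
noncomputable def timeAverage (x : (j : Fin J) → (Fin (d j + 1) → V × V) → ℕ → ℝ)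
    (j : Fin J) (k : Fin (d j + 1) → V × V) : ℝ :=
  if k ∈ RS L (src j) (dst j) (d j) then
    ((T + dmax d : ℕ) : ℝ)⁻¹ * ∑ t ∈ Finset.Icc 1 T, x j k t else 0

variable {L src dst d T}

lemma sum_timeAverage (x : (j : Fin J) → (Fin (d j + 1) → V × V) → ℕ → ℝ) (j : Fin J) :
    ∑ k ∈ RS L (src j) (dst j) (d j), timeAverage L src dst d T x j k =
      ((T + dmax d : ℕ) : ℝ)⁻¹ *
        ∑ t ∈ Finset.Icc 1 T, ∑ k ∈ RS L (src j) (dst j) (d j), x j k t := by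
  rw [Finset.sum_comm, Finset.mul_sum]
  exact Finset.sum_congr rfl fun k hk => if_pos hk

lemma schedAt_timeAverage (x : (j : Fin J) → (Fin (d j + 1) → V × V) → ℕ → ℝ)
    (j : Fin J) (s : ℕ) (ℓ : V × V) :
    schedAt L (src j) (dst j) (d j) (timeAverage L src dst d T x j) s ℓ =
      ((T + dmax d : ℕ) : ℝ)⁻¹ *
        ∑ t ∈ Finset.Icc 1 T, schedAt L (src j) (dst j) (d j) (fun k => x j k t) s ℓ := by
  rw [← schedAt_const_mul_sum]
  exact schedAt_congr _ _ _ _ (fun k hk => if_pos hk) _ _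

lemma EIFeasible.timeAverage {C : V × V → ℝ} (hT : 1 ≤ T) {lam : Fin J → ℝ}
    (hlam : ∀ j, 0 ≤ lam j) {x : (j : Fin J) → (Fin (d j + 1) → V × V) → ℕ → ℝ}
    (hx : EIFeasible L C src dst d T (fun j _ => lam j) x) :
    EIFeasible L C src dst d T (fun j _ => lam j)
      (fun j k _ => timeAverage L src dst d T x j k) := by
  obtain ⟨hx0, hx1, hxC⟩ := hx
  have hN : (0 : ℝ) < ((T + dmax d : ℕ) : ℝ) := by
    exact_mod_cast Nat.lt_of_lt_of_le hT (Nat.le_add_right _ _)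
  have hy0 : ∀ j k, 0 ≤ _root_.timeAverage L src dst d T x j k := by
    intro j k
    unfold _root_.timeAverage
    split_ifs
    · exact mul_nonneg (inv_nonneg.2 hN.le) (Finset.sum_nonneg fun t _ => hx0 j k t)
    · exact le_rfl
  refine ⟨fun j k _ => hy0 j k, fun j _ _ => ?_, fun ℓ hℓ t _ => ?_⟩
  · rw [sum_timeAverage, inv_mul_le_iff₀ hN, mul_one]
    calc _ ≤ ∑ t ∈ Finset.Icc 1 T, (1 : ℝ) := Finset.sum_le_sum fun t ht => hx1 j t ht
      _ ≤ ((T + dmax d : ℕ) : ℝ) := by simp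
  · calc _ ≤ ∑ s ∈ Finset.range (dmax d + 1), ∑ j, lam j *
          schedAt L (src j) (dst j) (d j) (_root_.timeAverage L src dst d T x j) s ℓ :=
        sum_window_le t T (dmax d) (b := fun s => ∑ j, lam j *
          schedAt L (src j) (dst j) (d j) (_root_.timeAverage L src dst d T x j) s ℓ) fun s =>
          Finset.sum_nonneg fun j _ =>
            mul_nonneg (hlam j) (schedAt_nonneg _ _ _ _ (hy0 j) _ _)
      _ = ((T + dmax d : ℕ) : ℝ)⁻¹ * ∑ τ ∈ Finset.Icc 1 T, ∑ s ∈ Finset.range (dmax d + 1),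
          ∑ j, lam j * schedAt L (src j) (dst j) (d j) (fun k => x j k τ) s ℓ := by
        rw [Finset.sum_comm (s := Finset.Icc 1 T), Finset.mul_sum]
        refine Finset.sum_congr rfl fun s _ => ?_
        rw [Finset.sum_comm, Finset.mul_sum]
        refine Finset.sum_congr rfl fun j _ => ?_
        rw [schedAt_timeAverage, ← Finset.mul_sum]
        ring
      _ ≤ C ℓ := by
        rw [← sum_window_eq T (dmax d) fun τ s =>
          ∑ j, lam j * schedAt L (src j) (dst j) (d j) (fun k => x j k τ) s ℓ,
          inv_mul_le_iff₀ hN]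
        refine (Finset.sum_le_sum fun t ht => hxC ℓ hℓ t ht).trans_eq ?_
        simp

lemma EIObj_timeAverage (w lam : Fin J → ℝ)
    (x : (j : Fin J) → (Fin (d j + 1) → V × V) → ℕ → ℝ) :
    EIObj L src dst d w T (fun j _ => lam j) (fun j k _ => timeAverage L src dst d T x j k) =
      T / ((T + dmax d : ℕ) : ℝ) * EIObj L src dst d w T (fun j _ => lam j) x := by
  unfold EIObj
  simp only [sum_timeAverage]
  rw [Finset.sum_const, Nat.card_Icc, Nat.add_sub_cancel, nsmul_eq_mul,
    Finset.sum_comm (s := Finset.Icc 1 T), Finset.mul_sum, Finset.mul_sum]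
  refine Finset.sum_congr rfl fun j _ => ?_
  rw [← Finset.mul_sum]
  ring

lemma EIObj_nonneg {w lam : Fin J → ℝ} (hw : ∀ j, 0 ≤ w j) (hlam : ∀ j, 0 ≤ lam j)
    {x : (j : Fin J) → (Fin (d j + 1) → V × V) → ℕ → ℝ} (hx : ∀ j k t, 0 ≤ x j k t) :
    0 ≤ EIObj L src dst d w T (fun j _ => lam j) x :=
  Finset.sum_nonneg fun t _ => Finset.sum_nonneg fun j _ =>
    mul_nonneg (mul_nonneg (hw j) (hlam j)) (Finset.sum_nonneg fun k _ => hx j k t)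

lemma EIFeasible.obj_le_EIOpt {C : V × V → ℝ} {w lam : Fin J → ℝ}
    (hw : ∀ j, 0 ≤ w j) (hlam : ∀ j, 0 ≤ lam j)
    {x : (j : Fin J) → (Fin (d j + 1) → V × V) → ℕ → ℝ}
    (hx : EIFeasible L C src dst d T (fun j _ => lam j) x) :
    EIObj L src dst d w T (fun j _ => lam j) x ≤
      EIOpt L C src dst d w T (fun j _ => lam j) := by
  refine le_csSup ⟨∑ t ∈ Finset.Icc 1 T, ∑ j, w j * lam j, ?_⟩ ⟨x, hx, rfl⟩
  rintro r ⟨y, hy, rfl⟩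
  exact Finset.sum_le_sum fun t ht => Finset.sum_le_sum fun j _ =>
    mul_le_of_le_one_right (mul_nonneg (hw j) (hlam j)) (hy.2.1 j t ht)

lemma timeAverage_le_one {C : V × V → ℝ} (hT : 1 ≤ T) {lam : Fin J → ℝ}
    (hlam : ∀ j, 0 ≤ lam j) {x : (j : Fin J) → (Fin (d j + 1) → V × V) → ℕ → ℝ}
    (hx : EIFeasible L C src dst d T (fun j _ => lam j) x) (j : Fin J)
    (k : Fin (d j + 1) → V × V) : timeAverage L src dst d T x j k ≤ 1 := by
  have hy := hx.timeAverage hT hlam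
  by_cases hk : k ∈ RS L (src j) (dst j) (d j)
  · exact (Finset.single_le_sum (f := timeAverage L src dst d T x j)
      (fun k _ => hy.1 j k 1) hk).trans (hy.2.1 j 1 (Finset.mem_Icc.2 ⟨le_rfl, hT⟩))
  · simp [timeAverage, hk]

variable (L src dst d T) in
lemma isCompact_stationary_feasible (C : V × V → ℝ) (lam : Fin J → ℝ) :
    IsCompact {y : (j : Fin J) → (Fin (d j + 1) → V × V) → ℝ |
      EIFeasible L C src dst d T (fun j _ => lam j) (fun j k _ => y j k) ∧ ∀ j k, y j k ≤ 1} := by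
  have hclosed : IsClosed {y : (j : Fin J) → (Fin (d j + 1) → V × V) → ℝ |
      EIFeasible L C src dst d T (fun j _ => lam j) (fun j k _ => y j k)} := by
    simp only [EIFeasible, Set.ofPred_and, Set.ofPred_forall]
    refine IsClosed.inter ?_ (IsClosed.inter ?_ ?_)
    · exact isClosed_iInter fun j => isClosed_iInter fun k => isClosed_iInter fun _ =>
        isClosed_le (by fun_prop) (by fun_prop)
    · exact isClosed_iInter fun j => isClosed_iInter fun t => isClosed_iInter fun _ =>
        isClosed_le (by fun_prop) (by fun_prop)
    · refine isClosed_iInter fun ℓ => isClosed_iInter fun _ => isClosed_iInter fun t =>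
        isClosed_iInter fun _ => isClosed_le ?_ continuous_const
      refine continuous_finsetSum _ fun τ _ => continuous_finsetSum _ fun j _ =>
        continuous_const.mul ?_
      exact (continuous_schedAt _ _ _ _ _ _).comp (continuous_apply j)
  have hIcc : IsCompact (Set.univ.pi fun j : Fin J =>
      Set.univ.pi fun _ : Fin (d j + 1) → V × V => Set.Icc (0 : ℝ) 1) :=
    isCompact_univ_pi fun _ => isCompact_univ_pi fun _ => isCompact_Icc
  convert hIcc.inter_right hclosed using 1
  ext y
  simp only [Set.mem_ofPred_eq, Set.mem_inter_iff, Set.mem_univ_pi, Set.mem_Icc]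
  exact ⟨fun h => ⟨fun j k => ⟨h.1.1 j k 0, h.2 j k⟩, h.1⟩,
    fun h => ⟨h.2, fun j k => (h.1 j k).2⟩⟩

end TimeAverage

lemma one_sub_two_mul_sq_div_le (T D : ℕ) (hT : 1 ≤ T) :
    1 - 2 * (D : ℝ) ^ 2 / T ≤ T / ((T + D : ℕ) : ℝ) := by
  have hT' : (0 : ℝ) < T := by exact_mod_cast hT
  have hD : (D : ℝ) ≤ (D : ℝ) ^ 2 := by exact_mod_cast Nat.le_self_pow two_ne_zero D
  have hD0 : (0 : ℝ) ≤ D := Nat.cast_nonneg D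
  push_cast
  rw [one_sub_div hT'.ne', div_le_div_iff₀ hT' (by positivity)]
  nlinarith [mul_nonneg hT'.le (sub_nonneg.2 hD), mul_nonneg hT'.le hD0,
    mul_nonneg hD0 (sq_nonneg (D : ℝ))]

/-- Near-optimality of stationary solutions of `EI(T)` under stationary arrival rates
`λ_j^t ≡ λ_j`: there is a time-independent feasible solution `x̄` whose objective value
is at least `(1 - 2 d_max² / T) W_EI(T)`; moreover every feasible solution (in
particular this one) has objective value at most `W_EI(T)`. -/
theorem stmt1 {V : Type} [Fintype V] [DecidableEq V]
    (L : Finset (V × V)) (C : V × V → ℝ) (hC : ∀ ℓ ∈ L, 0 < C ℓ)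
    {J : ℕ} (hJ : 1 ≤ J) (src dst : Fin J → V) (d : Fin J → ℕ)
    (w : Fin J → ℝ) (hw : ∀ j, 0 ≤ w j)
    (T : ℕ) (hT : 1 ≤ T)
    (lam : Fin J → ℝ) (hlam : ∀ j, 0 ≤ lam j) :
    (∀ x, EIFeasible L C src dst d T (fun j _ => lam j) x →
        EIObj L src dst d w T (fun j _ => lam j) x ≤
          EIOpt L C src dst d w T (fun j _ => lam j)) ∧
    ∃ xbar : (j : Fin J) → (Fin (d j + 1) → V × V) → ℝ,
      EIFeasible L C src dst d T (fun j _ => lam j) (fun j k _ => xbar j k) ∧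
      (1 - 2 * (dmax d : ℝ) ^ 2 / T) * EIOpt L C src dst d w T (fun j _ => lam j) ≤
        EIObj L src dst d w T (fun j _ => lam j) (fun j k _ => xbar j k) ∧
      EIObj L src dst d w T (fun j _ => lam j) (fun j k _ => xbar j k) ≤
        EIOpt L C src dst d w T (fun j _ => lam j) := by
  refine ⟨fun x hx => hx.obj_le_EIOpt hw hlam, ?_⟩
  have hzero : EIFeasible L C src dst d T (fun j _ => lam j) (fun _ _ _ => 0) :=
    ⟨fun _ _ _ => le_rfl, fun _ _ _ => by simp, fun ℓ hℓ t _ => by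
      simpa [schedAt] using (hC ℓ hℓ).le⟩
  obtain ⟨xbar, ⟨hfeas, -⟩, hmax⟩ :=
    (isCompact_stationary_feasible L src dst d T C lam).exists_isMaxOn
      ⟨fun _ _ => 0, hzero, fun _ _ => zero_le_one⟩
      (f := fun y => EIObj L src dst d w T (fun j _ => lam j) (fun j k _ => y j k))
      (by unfold EIObj; fun_prop)
  refine ⟨xbar, hfeas, ?_, hfeas.obj_le_EIOpt hw hlam⟩
  have hT' : (0 : ℝ) < T := by exact_mod_cast hT
  have hN : (0 : ℝ) < ((T + dmax d : ℕ) : ℝ) := by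
    exact_mod_cast Nat.lt_of_lt_of_le hT (Nat.le_add_right _ _)
  have hr : (0 : ℝ) < T / ((T + dmax d : ℕ) : ℝ) := div_pos hT' hN
  have hopt : 0 ≤ EIOpt L C src dst d w T (fun j _ => lam j) :=
    (EIObj_nonneg hw hlam hzero.1).trans (hzero.obj_le_EIOpt hw hlam)
  refine (mul_le_mul_of_nonneg_right (one_sub_two_mul_sq_div_le T (dmax d) hT) hopt).trans ?_
  rw [← le_div_iff₀' hr]
  refine csSup_le ⟨_, _, hzero, rfl⟩ ?_
  rintro r ⟨x, hx, rfl⟩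
  rw [le_div_iff₀' hr, ← EIObj_timeAverage]
  exact hmax ⟨hx.timeAverage hT hlam, timeAverage_le_one hT hlam hx⟩
end

section
/- Let T > 2·d_max and let x be a feasible solution of EI(T) (with stationary rates λ_j). Define x′ by x′_{jk}^t = 0 whenever t ≤ d_max or t > T − d_max, and x′_{jk}^t = x_{jk}^t otherwise. Then x′ is a feasible solution of the cyclically modified program ĒI(T). -/
open Finset

variable {V : Type} [Fintype V] [DecidableEq V]

/-- The representative in `[T] = {1, …, T}` of an integer time index `τ` modulo `T`. -/
def cyclicRep (T : ℕ) (τ : ℤ) : ℕ := ((τ - 1) % (T : ℤ)).toNat + 1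

/-- Feasibility for the cyclically modified program `ĒI(T)` (stationary rates `λ_j`):
`x ≥ 0`; `∑_{k ∈ K_j} x_{jk}^t ≤ 1` for all `j`, `t ∈ [T]`; and for every `ℓ ∈ L` and
`t ∈ [T]`: `∑_{τ = t - d_max}^{t} ∑_j λ_j ∑_{k ∈ K_j : k_{t-τ} = ℓ} x_{jk}^{τ'} ≤ C_ℓ`,
where `τ' ∈ [T]` is the representative of `τ` modulo `T`. -/
def EIbarFeasible (L : Finset (V × V)) (C : V × V → ℝ) {J : ℕ} (src dst : Fin J → V)
    (d : Fin J → ℕ) (T : ℕ) (lam : Fin J → ℝ)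
    (x : (j : Fin J) → (Fin (d j + 1) → V × V) → ℕ → ℝ) : Prop :=
  (∀ j k t, 0 ≤ x j k t) ∧
  (∀ j, ∀ t ∈ Finset.Icc 1 T, ∑ k ∈ RS L (src j) (dst j) (d j), x j k t ≤ 1) ∧
  (∀ ℓ ∈ L, ∀ t ∈ Finset.Icc 1 T,
    ∑ τ ∈ Finset.Icc ((t : ℤ) - (dmax d : ℤ)) (t : ℤ), ∑ j,
      lam j * schedAt L (src j) (dst j) (d j) (fun k => x j k (cyclicRep T τ))
        ((t : ℤ) - τ).toNat ℓ ≤ C ℓ)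

theorem cyclicRep_natCast {T n : ℕ} (h1 : 1 ≤ n) (hn : n ≤ T) : cyclicRep T n = n := by
  unfold cyclicRep
  rw [Int.emod_eq_of_lt (by omega) (by omega)]
  omega

theorem cyclicRep_of_nonpos {T : ℕ} {τ : ℤ} (h0 : τ ≤ 0) (hτ : -(T : ℤ) < τ) :
    (cyclicRep T τ : ℤ) = τ + T := by
  unfold cyclicRep
  rw [← Int.add_emod_right, Int.emod_eq_of_lt (by omega) (by omega)]
  omega

theorem schedAt_mono {V : Type} [Fintype V] [DecidableEq V] (L : Finset (V × V)) (s z : V)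
    (d : ℕ) {x y : (Fin (d + 1) → V × V) → ℝ} (hxy : ∀ k, x k ≤ y k) (τ : ℕ) (ℓ : V × V) :
    schedAt L s z d x τ ℓ ≤ schedAt L s z d y τ ℓ := by
  unfold schedAt
  refine Finset.sum_le_sum fun k _ => ?_
  split_ifs
  · exact hxy k
  · exact le_rfl
  · exact le_rfl

theorem schedAt_zero {V : Type} [Fintype V] [DecidableEq V] (L : Finset (V × V)) (s z : V)
    (d τ : ℕ) (ℓ : V × V) : schedAt L s z d (fun _ => 0) τ ℓ = 0 := by
  simp [schedAt]

theorem sum_Icc_int_eq_sum_Icc_nat {D t : ℕ} {f : ℤ → ℝ}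
    (hf : ∀ τ : ℤ, (t : ℤ) - D ≤ τ → τ ≤ 0 → f τ = 0) :
    ∑ τ ∈ Finset.Icc ((t : ℤ) - D) t, f τ = ∑ τ ∈ Finset.Icc (max (t - D) 1) t, f (τ : ℤ) := by
  symm
  refine Finset.sum_of_injOn (fun n : ℕ => (n : ℤ)) (Nat.cast_injective.injOn) ?_ ?_
    fun _ _ => rfl
  · intro n hn
    simp only [Finset.coe_Icc, Set.mem_Icc] at hn ⊢
    omega
  · intro τ hτ hn
    rw [Finset.mem_Icc] at hτ
    refine hf τ hτ.1 (not_lt.mp fun hpos => hn ⟨τ.toNat, ?_, ?_⟩)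
    · simp only [Finset.coe_Icc, Set.mem_Icc]
      omega
    · simpa using hpos.le

/-- Zeroing out a feasible solution of `EI(T)` on the boundary time slots
(`t ≤ d_max` or `t > T - d_max`) yields a feasible solution of the cyclically
modified program `ĒI(T)`. -/
theorem stmt3 {V : Type} [Fintype V] [DecidableEq V]
    (L : Finset (V × V)) (C : V × V → ℝ) (hC : ∀ ℓ ∈ L, 0 < C ℓ)
    {J : ℕ} (hJ : 1 ≤ J) (src dst : Fin J → V) (d : Fin J → ℕ)
    (w : Fin J → ℝ) (hw : ∀ j, 0 ≤ w j)
    (T : ℕ) (hT : 2 * dmax d < T)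
    (lam : Fin J → ℝ) (hlam : ∀ j, 0 ≤ lam j)
    (x : (j : Fin J) → (Fin (d j + 1) → V × V) → ℕ → ℝ)
    (hx : EIFeasible L C src dst d T (fun j _ => lam j) x) :
    EIbarFeasible L C src dst d T lam
      (fun j k t => if t ≤ dmax d ∨ T - dmax d < t then 0 else x j k t) := by
  obtain ⟨hnonneg, hone, hcap⟩ := hx
  have hle : ∀ (j : Fin J) (k : Fin (d j + 1) → V × V) (t : ℕ),
      (if t ≤ dmax d ∨ T - dmax d < t then 0 else x j k t) ≤ x j k t := by
    intro j k t
    split_ifs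
    · exact hnonneg j k t
    · exact le_rfl
  refine ⟨?_, ?_, ?_⟩
  · intro j k t
    dsimp only
    split_ifs
    · exact le_rfl
    · exact hnonneg j k t
  · exact fun j t ht => (Finset.sum_le_sum fun k _ => hle j k t).trans (hone j t ht)
  · intro ℓ hℓ t ht
    have ht' := Finset.mem_Icc.mp ht
    rw [sum_Icc_int_eq_sum_Icc_nat]
    · refine le_trans ?_ (hcap ℓ hℓ t (Finset.mem_Icc.mpr ⟨ht'.1, by omega⟩))
      rw [min_eq_left ht'.2]
      refine Finset.sum_le_sum fun τ hτ => Finset.sum_le_sum fun j _ =>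
        mul_le_mul_of_nonneg_left ?_ (hlam j)
      rw [Finset.mem_Icc] at hτ
      rw [cyclicRep_natCast (by omega) (by omega), show ((t : ℤ) - τ).toNat = t - τ by omega]
      exact schedAt_mono L _ _ _ (fun k => hle j k τ) _ _
    · intro τ hτ hτ0
      have hrep : T - dmax d < cyclicRep T τ := by
        have := cyclicRep_of_nonpos (T := T) hτ0 (by omega)
        omega
      simp [hrep, schedAt_zero]
end

section
/- Let Λ ≥ 1 be a natural number, set ε := 2^{−Λ}, let T′ > 0 and c > 0 be real numbers, define T_φ := ε · T′ · 2^{φ−1} for φ ∈ {1, …, Λ}, and define ε_φ := √(c / T_φ). If T′ ≥ c / ((√2 − 1)² · ε²), then Σ_{φ=1}^{Λ} (T_φ / T′) · ε_φ ≤ ε. -/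
/-- Each weighted phase error is a geometric term with ratio `√2`. -/
theorem weighted_sqrt_div_eq (n k : ℕ) {T c : ℝ} (hT : 0 < T) (hc : 0 < c) :
    (((2 : ℝ) ^ n)⁻¹ * T * 2 ^ k / T) * √(c / (((2 : ℝ) ^ n)⁻¹ * T * 2 ^ k)) =
      √(c / T) / √2 ^ n * √2 ^ k := by
  have h2 (m : ℕ) : (2 : ℝ) ^ m = (√2 ^ m) ^ 2 := by
    rw [← pow_mul, mul_comm, pow_mul, Real.sq_sqrt zero_le_two]
  have hn : 0 < √2 ^ n := by positivity
  have hk : 0 < √2 ^ k := by positivity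
  have hsq : c / (((2 : ℝ) ^ n)⁻¹ * T * 2 ^ k) = (√(c / T) * √2 ^ n / √2 ^ k) ^ 2 := by
    rw [div_pow, mul_pow, Real.sq_sqrt (by positivity), ← h2, ← h2]
    field_simp
  rw [hsq, Real.sqrt_sq (by positivity), h2 n, h2 k]
  field_simp

/-- With `ε = 2^(-Λ)`, phase lengths `T_φ = ε T' 2^(φ-1)` and per-phase estimation
accuracies `ε_φ = √(c / T_φ)`, if `T' ≥ c / ((√2 - 1)² ε²)` then the time-weighted
accumulated estimation error `∑_{φ=1}^{Λ} (T_φ / T') ε_φ` is at most `ε`. -/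
theorem stmt15 (Λ : ℕ) (hΛ : 1 ≤ Λ) (ε : ℝ) (hε : ε = (2 : ℝ) ^ (-(Λ : ℤ)))
    (T' c : ℝ) (hT' : 0 < T') (hc : 0 < c)
    (hTbig : c / ((Real.sqrt 2 - 1) ^ 2 * ε ^ 2) ≤ T') :
    ∑ φ ∈ Finset.Icc 1 Λ,
        (ε * T' * 2 ^ (φ - 1) / T') * Real.sqrt (c / (ε * T' * 2 ^ (φ - 1))) ≤ ε := by
  have hs : 0 < √2 - 1 := sub_pos.2 Real.one_lt_sqrt_two
  have hε' : ε = ((2 : ℝ) ^ Λ)⁻¹ := by rw [hε, zpow_neg, zpow_natCast]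
  have hεpos : 0 < ε := by rw [hε']; positivity
  have ha : √(c / T') ≤ ε * (√2 - 1) := by
    refine Real.sqrt_le_iff.2 ⟨by positivity, ?_⟩
    rw [div_le_iff₀ (by positivity)] at hTbig
    rw [div_le_iff₀ hT']
    linarith
  have hsum : ∑ φ ∈ Finset.Icc 1 Λ,
      (ε * T' * 2 ^ (φ - 1) / T') * √(c / (ε * T' * 2 ^ (φ - 1))) =
        √(c / T') / √2 ^ Λ * ((√2 ^ Λ - 1) / (√2 - 1)) := by
    rw [← geom_sum_eq Real.one_lt_sqrt_two.ne', Finset.mul_sum, ← Finset.Ico_add_one_right_eq_Icc,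
      Finset.sum_Ico_eq_sum_range]
    refine Finset.sum_congr (by simp) fun k _ => ?_
    rw [Nat.add_sub_cancel_left, hε', weighted_sqrt_div_eq Λ k hT' hc]
  rw [hsum]
  calc √(c / T') / √2 ^ Λ * ((√2 ^ Λ - 1) / (√2 - 1))
      ≤ √(c / T') / √2 ^ Λ * (√2 ^ Λ / (√2 - 1)) := by gcongr; linarith
    _ = √(c / T') / (√2 - 1) := by field_simp
    _ ≤ ε := (div_le_iff₀ hs).2 ha
end
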